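/- Under assumptions (a), (b) and the bounded gradient assumption, consider the SSMG iterates with fixed T ≥ 1, momentum weight β := (ν/T^{2/3})^{1/n} for some ν ≥ 0 such that β ≤ ((R−1)/R)^{1/n} for some R ≥ 1, and constant learning rate η_t := γ/T^{1/3} for some γ > 0 with γ/T^{1/3} ≤ 1/L. Then (1/Σ_{t=1}^T η_t) · Σ_{t=1}^T η_t·‖∇F(w̃_{t−1})‖² ≤ D_0/T^{2/3} + R·‖∇F(w̃_0)‖²/T + 2·L·G²·R·γ/T^{4/3}, where D_0 := (2R/γ)·(F(w̃_0) − F_*) + (R/(γ·L))·‖∇F(w̃_0)‖² + L²·G²·γ² + 4·ν·G²·R. -/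

import Mathlib

open Finset

section Descent

variable {E : Type*} [NormedAddCommGroup E] [InnerProductSpace ℝ E] [CompleteSpace E]

/-- The quadratic upper bound for a function with Lipschitz gradient. -/
lemma descent_of_lipschitz_gradient {F : E → ℝ} {A : E → E} {L : ℝ}
    (hA : ∀ x, HasGradientAt F (A x) x) (hLip : ∀ x y, ‖A x - A y‖ ≤ L * ‖x - y‖) (x v : E) :
    F (x + v) ≤ F x + inner ℝ (A x) v + L / 2 * ‖v‖ ^ 2 := by
  have hline : ∀ t : ℝ, HasDerivAt (fun t : ℝ => x + t • v) v t := fun t => by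
    simpa using ((hasDerivAt_id t).smul_const v).const_add x
  have hder : ∀ t : ℝ, HasDerivAt
      (fun t : ℝ => F (x + t • v) - t * inner ℝ (A x) v - L / 2 * ‖v‖ ^ 2 * t ^ 2)
      (inner ℝ (A (x + t • v)) v - inner ℝ (A x) v - L * ‖v‖ ^ 2 * t) t := fun t => by
    have hF := (hA (x + t • v)).hasFDerivAt.comp_hasDerivAt t (hline t)
    have hlin := (hasDerivAt_id t).mul_const (inner ℝ (A x) v)
    have hsq := ((hasDerivAt_id t).pow 2).const_mul (L / 2 * ‖v‖ ^ 2)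
    refine ((hF.sub hlin).sub hsq).congr_deriv ?_
    simp
    ring
  have hanti : AntitoneOn
      (fun t : ℝ => F (x + t • v) - t * inner ℝ (A x) v - L / 2 * ‖v‖ ^ 2 * t ^ 2)
      (Set.Icc 0 1) := by
    refine antitoneOn_of_deriv_nonpos (convex_Icc 0 1)
      (fun t _ => (hder t).continuousAt.continuousWithinAt)
      (fun t _ => (hder t).differentiableAt.differentiableWithinAt) fun t ht => ?_
    rw [interior_Icc] at ht
    rw [(hder t).deriv, ← inner_sub_left]
    have h₁ := real_inner_le_norm (A (x + t • v) - A x) v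
    have h₂ := hLip (x + t • v) x
    rw [add_sub_cancel_left, norm_smul, Real.norm_of_nonneg ht.1.le] at h₂
    nlinarith [mul_le_mul_of_nonneg_right h₂ (norm_nonneg v)]
  have h := hanti (Set.left_mem_Icc.2 zero_le_one) (Set.right_mem_Icc.2 zero_le_one) zero_le_one
  simp at h
  linarith

/-- One step `x ↦ x - η • v` decreases `F` up to the error of `v` as an estimate of the gradient. -/
lemma descent_step {F : E → ℝ} {A : E → E} {L η : ℝ}
    (hA : ∀ x, HasGradientAt F (A x) x) (hLip : ∀ x y, ‖A x - A y‖ ≤ L * ‖x - y‖)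
    (hη : 0 ≤ η) (hηL : η * L ≤ 1) (x v : E) :
    F (x - η • v) ≤ F x - η / 2 * ‖A x‖ ^ 2 + η / 2 * ‖v - A x‖ ^ 2 := by
  have h := descent_of_lipschitz_gradient hA hLip x (-(η • v))
  rw [← sub_eq_add_neg, norm_neg, norm_smul, Real.norm_of_nonneg hη, inner_neg_right,
    real_inner_smul_right] at h
  rw [norm_sub_sq_real, real_inner_comm]
  nlinarith [mul_le_mul_of_nonneg_left hηL (mul_nonneg hη (sq_nonneg ‖v‖))]

/-- One step `x ↦ x - η • v` with a bounded direction increases `F` by a controlled amount. -/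
lemma bounded_step {F : E → ℝ} {A : E → E} {L η G : ℝ}
    (hA : ∀ x, HasGradientAt F (A x) x) (hLip : ∀ x y, ‖A x - A y‖ ≤ L * ‖x - y‖)
    (hL : 0 < L) (hη : 0 ≤ η) (x v : E) (hv : ‖v‖ ≤ G) :
    F (x - η • v) ≤ F x + 1 / (2 * L) * ‖A x‖ ^ 2 + L * η ^ 2 * G ^ 2 := by
  have h := descent_of_lipschitz_gradient hA hLip x (-(η • v))
  have hin := real_inner_le_norm (A x) (-(η • v))
  rw [norm_neg, norm_smul, Real.norm_of_nonneg hη] at hin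
  rw [← sub_eq_add_neg, norm_neg, norm_smul, Real.norm_of_nonneg hη] at h
  have hsq : ‖v‖ ^ 2 ≤ G ^ 2 := by gcongr
  have hyoung : ‖A x‖ * (η * ‖v‖) ≤ 1 / (2 * L) * ‖A x‖ ^ 2 + L / 2 * (η * ‖v‖) ^ 2 := by
    have : 1 / (2 * L) * ‖A x‖ ^ 2 + L / 2 * (η * ‖v‖) ^ 2 - ‖A x‖ * (η * ‖v‖)
        = 1 / (2 * L) * (‖A x‖ - L * (η * ‖v‖)) ^ 2 := by
      field_simp
      ring
    have : 0 ≤ 1 / (2 * L) * (‖A x‖ - L * (η * ‖v‖)) ^ 2 := by positivity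
    linarith
  have : L * η ^ 2 * ‖v‖ ^ 2 ≤ L * η ^ 2 * G ^ 2 := by gcongr
  nlinarith

end Descent

section CyclicMomentum

variable {E : Type*} [NormedAddCommGroup E] [InnerProductSpace ℝ E]

/-- Full windows of a periodic sequence have the same sum. -/
lemma sum_range_shift_of_periodic {V : Type*} [AddCommGroup V] {n : ℕ} {u : ℕ → V}
    (hper : ∀ s, u (s + n) = u s) (j : ℕ) :
    ∑ i ∈ range n, u (j + i) = ∑ i ∈ range n, u i := by
  induction j with
  | zero => simp
  | succ j ih =>
    rw [← ih]
    have h₁ := sum_range_succ (fun i => u (j + i)) n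
    have h₂ := sum_range_succ' (fun i => u (j + i)) n
    rw [h₁, hper, add_zero] at h₂
    rw [add_right_cancel h₂]
    exact sum_congr rfl fun i _ => by congr 1; omega

/-- The squared norm of a convex combination is at most that of the squared norms. -/
lemma sq_norm_convex_comb_le {β : ℝ} (hβ0 : 0 ≤ β) (hβ1 : β ≤ 1) (x y : E) :
    ‖β • x + (1 - β) • y‖ ^ 2 ≤ β * ‖x‖ ^ 2 + (1 - β) * ‖y‖ ^ 2 := by
  have h : ‖β • x + (1 - β) • y‖ ≤ β * ‖x‖ + (1 - β) * ‖y‖ := by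
    refine (norm_add_le _ _).trans_eq ?_
    rw [norm_smul, norm_smul, Real.norm_of_nonneg hβ0, Real.norm_of_nonneg (sub_nonneg.2 hβ1)]
  have h' := pow_le_pow_left₀ (norm_nonneg _) h 2
  nlinarith [mul_nonneg (mul_nonneg hβ0 (sub_nonneg.2 hβ1)) (sq_nonneg (‖x‖ - ‖y‖))]

/-- An average of vectors of norm at most `C` has norm at most `C`. -/
lemma norm_average_le {n : ℕ} (hn : 1 ≤ n) {u : ℕ → E} {C : ℝ}
    (hu : ∀ i < n, ‖u i‖ ≤ C) : ‖(1 / (n : ℝ)) • ∑ i ∈ range n, u i‖ ≤ C := by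
  have hn' : (0 : ℝ) < n := by exact_mod_cast hn
  have h := norm_sum_le_of_le (range n) fun i hi => hu i (mem_range.1 hi)
  rw [sum_const, card_range, nsmul_eq_mul] at h
  rw [norm_smul, Real.norm_of_nonneg (by positivity), one_div, inv_mul_le_iff₀ hn']
  exact h

/-- Momentum iterates `W` with momentum `M`, step size `η / n` and component gradients `a s`
visited cyclically with period `n`; `A` is the average of the components over a period. -/
structure IsCyclicMomentum (n : ℕ) (a : ℕ → E → E) (A : E → E) (β η G L : ℝ)
    (W M : ℕ → E) : Prop where
  one_le : 1 ≤ n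
  beta_nonneg : 0 ≤ β
  beta_le_one : β ≤ 1
  step_nonneg : 0 ≤ η
  lip_nonneg : 0 ≤ L
  periodic : ∀ s, a (s + n) = a s
  average : ∀ x, A x = (1 / (n : ℝ)) • ∑ i ∈ range n, a i x
  bounded : ∀ s x, ‖a s x‖ ≤ G
  lipschitz : ∀ s x y, ‖a s x - a s y‖ ≤ L * ‖x - y‖
  momentum_zero : M 0 = 0
  momentum_succ : ∀ s, M (s + 1) = β • M s + (1 - β) • a s (W s)
  iterate_succ : ∀ s, W (s + 1) = W s - (η / n) • M (s + 1)

namespace IsCyclicMomentum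

variable {n : ℕ} {a : ℕ → E → E} {A : E → E} {β η G L : ℝ} {W M : ℕ → E}

lemma bound_nonneg (h : IsCyclicMomentum n a A β η G L W M) : 0 ≤ G :=
  (norm_nonneg _).trans (h.bounded 0 0)

lemma norm_momentum_le (h : IsCyclicMomentum n a A β η G L W M) (s : ℕ) : ‖M s‖ ≤ G := by
  induction s with
  | zero => simpa [h.momentum_zero] using h.bound_nonneg
  | succ s ih =>
    rw [h.momentum_succ]
    refine (norm_add_le _ _).trans ?_
    rw [norm_smul, norm_smul, Real.norm_of_nonneg h.beta_nonneg,
      Real.norm_of_nonneg (sub_nonneg.2 h.beta_le_one)]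
    nlinarith [mul_le_mul_of_nonneg_left ih h.beta_nonneg,
      mul_le_mul_of_nonneg_left (h.bounded s (W s)) (sub_nonneg.2 h.beta_le_one)]

lemma iterate_add (h : IsCyclicMomentum n a A β η G L W M) (s k : ℕ) :
    W (s + k) = W s - (η / n) • ∑ i ∈ range k, M (s + i + 1) := by
  induction k with
  | zero => simp
  | succ k ih =>
    rw [← add_assoc, h.iterate_succ, ih, sum_range_succ, smul_add]
    abel

lemma norm_iterate_add_sub_le (h : IsCyclicMomentum n a A β η G L W M) (s : ℕ) {k : ℕ}
    (hk : k ≤ n) : ‖W (s + k) - W s‖ ≤ η * G := by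
  have hn : (0 : ℝ) < n := by exact_mod_cast h.one_le
  have hsum := norm_sum_le_of_le (range k) fun i _ => h.norm_momentum_le (s + i + 1)
  rw [sum_const, card_range, nsmul_eq_mul] at hsum
  have hkG : (k : ℝ) * G ≤ n * G :=
    mul_le_mul_of_nonneg_right (by exact_mod_cast hk) h.bound_nonneg
  rw [h.iterate_add, sub_sub_cancel_left, norm_neg, norm_smul,
    Real.norm_of_nonneg (div_nonneg h.step_nonneg hn.le)]
  calc η / n * ‖∑ i ∈ range k, M (s + i + 1)‖ ≤ η / n * (n * G) :=
        mul_le_mul_of_nonneg_left (hsum.trans hkG) (div_nonneg h.step_nonneg hn.le)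
    _ = η * G := by field_simp

lemma norm_iterate_sub_le (h : IsCyclicMomentum n a A β η G L W M) {s r : ℕ}
    (hsr : s ≤ r + n) (hrs : r ≤ s + n) : ‖W s - W r‖ ≤ η * G := by
  rcases le_total s r with hle | hle <;> obtain ⟨k, rfl⟩ := Nat.exists_eq_add_of_le hle
  · rw [norm_sub_rev]
    exact h.norm_iterate_add_sub_le s (by omega)
  · exact h.norm_iterate_add_sub_le r (by omega)

lemma norm_average_gradient_le (h : IsCyclicMomentum n a A β η G L W M) (x : E) : ‖A x‖ ≤ G := by
  rw [h.average]
  exact norm_average_le h.one_le fun i _ => h.bounded i x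

lemma norm_window_sub_le (h : IsCyclicMomentum n a A β η G L W M) {j r : ℕ}
    (hjr : j ≤ r) (hrj : r ≤ j + n) :
    ‖(1 / (n : ℝ)) • ∑ i ∈ range n, a (j + i) (W (j + i)) - A (W r)‖ ≤ L * (η * G) := by
  have hA : A (W r) = (1 / (n : ℝ)) • ∑ i ∈ range n, a (j + i) (W r) := by
    rw [h.average, sum_range_shift_of_periodic (u := fun s => a s (W r))
      (fun s => by rw [h.periodic])]
  rw [hA, ← smul_sub, ← sum_sub_distrib]
  refine norm_average_le h.one_le fun i hi => (h.lipschitz _ _ _).trans ?_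
  exact mul_le_mul_of_nonneg_left (h.norm_iterate_sub_le (by omega) (by omega)) h.lip_nonneg

/-- Averaging the momentum over a window and sliding the window forward forgets the initial
error geometrically. -/
lemma sq_norm_momentum_window_sub_le (h : IsCyclicMomentum n a A β η G L W M) (s : ℕ) {j : ℕ}
    (hj : j ≤ n) :
    ‖(1 / (n : ℝ)) • ∑ i ∈ range n, M (s + j + i + 1) - A (W (s + n))‖ ^ 2
      ≤ β ^ j * (4 * G ^ 2) + (1 - β ^ j) * (L * (η * G)) ^ 2 := by
  induction j with
  | zero =>
    have h₁ : ‖(1 / (n : ℝ)) • ∑ i ∈ range n, M (s + 0 + i + 1)‖ ≤ G :=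
      norm_average_le h.one_le fun i _ => h.norm_momentum_le _
    have h₂ := (norm_sub_le _ _).trans (add_le_add h₁ (h.norm_average_gradient_le (W (s + n))))
    have h₃ := pow_le_pow_left₀ (norm_nonneg _) h₂ 2
    rw [pow_zero]
    linarith
  | succ j ih =>
    have hrec : (1 / (n : ℝ)) • ∑ i ∈ range n, M (s + (j + 1) + i + 1) - A (W (s + n))
        = β • ((1 / (n : ℝ)) • ∑ i ∈ range n, M (s + j + i + 1) - A (W (s + n)))
          + (1 - β) • ((1 / (n : ℝ)) • ∑ i ∈ range n,
              a (s + (j + 1) + i) (W (s + (j + 1) + i)) - A (W (s + n))) := by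
      have hsum : ∑ i ∈ range n, M (s + (j + 1) + i + 1)
          = β • ∑ i ∈ range n, M (s + j + i + 1)
            + (1 - β) • ∑ i ∈ range n, a (s + (j + 1) + i) (W (s + (j + 1) + i)) := by
        rw [smul_sum, smul_sum, ← sum_add_distrib]
        refine sum_congr rfl fun i _ => ?_
        rw [h.momentum_succ, show s + (j + 1) + i = s + j + i + 1 by omega]
      rw [hsum]
      module
    have hwin := pow_le_pow_left₀ (norm_nonneg _)
      (h.norm_window_sub_le (j := s + (j + 1)) (r := s + n) (by omega) (by omega)) 2
    rw [hrec]
    refine (sq_norm_convex_comb_le h.beta_nonneg h.beta_le_one _ _).trans ?_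
    have h₁ := mul_le_mul_of_nonneg_left (ih (by omega)) h.beta_nonneg
    have h₂ := mul_le_mul_of_nonneg_left hwin (sub_nonneg.2 h.beta_le_one)
    refine (add_le_add h₁ h₂).trans_eq ?_
    ring

lemma iterate_add_period (h : IsCyclicMomentum n a A β η G L W M) (s : ℕ) :
    W (s + n) = W s - η • ((1 / (n : ℝ)) • ∑ i ∈ range n, M (s + i + 1)) := by
  rw [h.iterate_add, smul_smul, mul_one_div]

/-- The sum of squared gradient norms at the starting points of the periods. -/
lemma sum_sq_norm_gradient_le [CompleteSpace E] (h : IsCyclicMomentum n a A β η G L W M)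
    {F : E → ℝ} (hA : ∀ x, HasGradientAt F (A x) x) (hL : 0 < L) (hηL : η * L ≤ 1) (T : ℕ) :
    η / 2 * ∑ t ∈ range (T + 1), ‖A (W (t * n))‖ ^ 2
      ≤ F (W 0) - F (W ((T + 1) * n)) + η / 2 * ‖A (W 0)‖ ^ 2 + 1 / (2 * L) * ‖A (W 0)‖ ^ 2
        + L * η ^ 2 * G ^ 2 + T * (η / 2 * (β ^ n * (4 * G ^ 2) + (L * (η * G)) ^ 2)) := by
  have hLip : ∀ x y, ‖A x - A y‖ ≤ L * ‖x - y‖ := fun x y => by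
    rw [h.average, h.average, ← smul_sub, ← sum_sub_distrib]
    exact norm_average_le h.one_le fun i _ => h.lipschitz i x y
  induction T with
  | zero =>
    have h₁ := bounded_step hA hLip hL h.step_nonneg (W 0)
      ((1 / (n : ℝ)) • ∑ i ∈ range n, M (0 + i + 1))
      (norm_average_le h.one_le fun i _ => h.norm_momentum_le _)
    rw [← h.iterate_add_period, zero_add] at h₁
    simp only [zero_add, range_one, sum_singleton, zero_mul, one_mul, Nat.cast_zero]
    linarith
  | succ T ih =>
    have h₁ := descent_step hA hLip h.step_nonneg hηL (W ((T + 1) * n))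
      ((1 / (n : ℝ)) • ∑ i ∈ range n, M ((T + 1) * n + i + 1))
    rw [← h.iterate_add_period, ← Nat.succ_mul] at h₁
    have h₂ := h.sq_norm_momentum_window_sub_le (T * n) le_rfl
    rw [← Nat.succ_mul] at h₂
    have h₃ : ‖(1 / (n : ℝ)) • ∑ i ∈ range n, M ((T + 1) * n + i + 1) - A (W ((T + 1) * n))‖ ^ 2
        ≤ β ^ n * (4 * G ^ 2) + (L * (η * G)) ^ 2 := by
      refine h₂.trans ?_
      nlinarith [mul_nonneg (pow_nonneg h.beta_nonneg n) (sq_nonneg (L * (η * G)))]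
    have h₄ := mul_le_mul_of_nonneg_left h₃ (div_nonneg h.step_nonneg zero_le_two)
    rw [sum_range_succ, mul_add]
    push_cast
    linarith

end IsCyclicMomentum

/-- The momentum recursion has a solution from every starting point. -/
lemma exists_momentum_iterates (a : ℕ → E → E) (β c : ℝ) (x : E) :
    ∃ W M : ℕ → E, W 0 = x ∧ M 0 = 0 ∧
      (∀ s, M (s + 1) = β • M s + (1 - β) • a s (W s)) ∧
      ∀ s, W (s + 1) = W s - c • M (s + 1) := by
  let state : ℕ → E × E := fun s => Nat.rec (x, 0) (fun s p =>
    (p.1 - c • (β • p.2 + (1 - β) • a s p.1), β • p.2 + (1 - β) • a s p.1)) s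
  exact ⟨fun s => (state s).1, fun s => (state s).2, rfl, rfl, fun _ => rfl, fun _ => rfl⟩

end CyclicMomentum

theorem ssmg_constant_lr
    (n d : ℕ) (hn : 1 ≤ n) (hd : 1 ≤ d)
    (f : Fin n → EuclideanSpace ℝ (Fin d) → ℝ)
    (hf : ∀ i, Differentiable ℝ (f i))
    (F : EuclideanSpace ℝ (Fin d) → ℝ)
    (hF : F = fun x => (1 / (n : ℝ)) * ∑ i, f i x)
    (L : ℝ) (hL : 0 < L)
    (hsmooth : ∀ i x y, ‖gradient (f i) x - gradient (f i) y‖ ≤ L * ‖x - y‖)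
    (Fstar : ℝ) (hFstar : IsGLB (Set.range F) Fstar)
    (G : ℝ) (hG : 0 < G)
    (hbg : ∀ i x, ‖gradient (f i) x‖ ≤ G)
    (T : ℕ) (hT : 1 ≤ T)
    (β : ℝ) (hβ0 : 0 ≤ β) (hβ1 : β < 1)
    (η : ℕ → ℝ) (hηpos : ∀ t, 1 ≤ t → t ≤ T → 0 < η t)
    (π : Equiv.Perm (Fin n))
    (w m g : ℕ → ℕ → EuclideanSpace ℝ (Fin d))
    (wt mt : ℕ → EuclideanSpace ℝ (Fin d))
    (hmt0 : mt 0 = 0)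
    (hw0 : ∀ t, 1 ≤ t → t ≤ T → w t 0 = wt (t - 1))
    (hm0 : ∀ t, 1 ≤ t → t ≤ T → m t 0 = mt (t - 1))
    (hg : ∀ t, 1 ≤ t → t ≤ T → ∀ i, ∀ hi : i < n,
        g t i = gradient (f (π ⟨i, hi⟩)) (w t i))
    (hm1 : ∀ t, 1 ≤ t → t ≤ T → ∀ i, i < n →
        m t (i + 1) = β • m t i + (1 - β) • g t i)
    (hw1 : ∀ t, 1 ≤ t → t ≤ T → ∀ i, i < n →
        w t (i + 1) = w t i - (η t / (n : ℝ)) • m t (i + 1))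
    (hwt : ∀ t, 1 ≤ t → t ≤ T → wt t = w t n)
    (hmt : ∀ t, 1 ≤ t → t ≤ T → mt t = m t n)
    (ν R γ : ℝ) (hν : 0 ≤ ν) (hR : 1 ≤ R) (hγ : 0 < γ)
    (hβdef : β = (ν / (T : ℝ) ^ ((2 : ℝ) / 3)) ^ ((1 : ℝ) / (n : ℝ)))
    (hβR : β ≤ ((R - 1) / R) ^ ((1 : ℝ) / (n : ℝ)))
    (hη : ∀ t, η t = γ / (T : ℝ) ^ ((1 : ℝ) / 3))
    (hηL : γ / (T : ℝ) ^ ((1 : ℝ) / 3) ≤ 1 / L) :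
    (∑ t ∈ Icc 1 T, η t * ‖gradient F (wt (t - 1))‖ ^ 2) / (∑ t ∈ Icc 1 T, η t)
      ≤ (2 * R / γ * (F (wt 0) - Fstar) + R / (γ * L) * ‖gradient F (wt 0)‖ ^ 2
            + L ^ 2 * G ^ 2 * γ ^ 2 + 4 * ν * G ^ 2 * R) / (T : ℝ) ^ ((2 : ℝ) / 3)
        + R * ‖gradient F (wt 0)‖ ^ 2 / (T : ℝ)
        + 2 * L * G ^ 2 * R * γ / (T : ℝ) ^ ((4 : ℝ) / 3) := by
  have hn' : (0 : ℝ) < n := by exact_mod_cast hn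
  have hT' : (0 : ℝ) < T := by exact_mod_cast hT
  obtain ⟨c, hc⟩ : ∃ c, c = (T : ℝ) ^ ((1 : ℝ) / 3) := ⟨_, rfl⟩
  have hc0 : 0 < c := hc ▸ Real.rpow_pos_of_pos hT' _
  have hpow : ∀ k : ℕ, (T : ℝ) ^ ((k : ℝ) / 3) = c ^ k := fun k => by
    rw [hc, ← Real.rpow_natCast, ← Real.rpow_mul hT'.le]
    congr 1
    ring
  have hc3 : (T : ℝ) = c ^ 3 := by simpa using hpow 3
  have hc2 : (T : ℝ) ^ ((2 : ℝ) / 3) = c ^ 2 := by simpa using hpow 2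
  have hc4 : (T : ℝ) ^ ((4 : ℝ) / 3) = c ^ 4 := by simpa using hpow 4
  rw [hc2] at hβdef
  have hβn : β ^ n = ν / c ^ 2 := by
    rw [hβdef, one_div, Real.rpow_inv_natCast_pow (by positivity) (by omega)]
  set η₀ : ℝ := γ / c with hη₀
  have hη' : ∀ t, η t = η₀ := fun t => by rw [hη, ← hc]
  have hη₀pos : 0 < η₀ := div_pos hγ hc0
  have hη₀L : η₀ * L ≤ 1 := by
    rw [← hc] at hηL
    exact (le_div_iff₀ hL).1 hηL
  let p : ℕ → Fin n := fun s => π ⟨s % n, Nat.mod_lt s hn⟩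
  let a : ℕ → EuclideanSpace ℝ (Fin d) → EuclideanSpace ℝ (Fin d) := fun s => gradient (f (p s))
  have hgradF : ∀ x, HasGradientAt F ((1 / (n : ℝ)) • ∑ i ∈ range n, a i x) x := fun x => by
    have hsum : ∑ i ∈ range n, a i x = ∑ i, gradient (f i) x := by
      rw [← Equiv.sum_comp π, sum_range]
      refine sum_congr rfl fun i _ => ?_
      simp only [a, p, Nat.mod_eq_of_lt i.2]
    rw [hsum, hF, hasGradientAt_iff_hasFDerivAt, map_smul, map_sum]
    exact (HasFDerivAt.fun_sum fun i _ =>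
      (hf i x).hasGradientAt.hasFDerivAt).const_mul (1 / (n : ℝ))
  obtain ⟨W, M, hW0, hM0, hM1, hW1⟩ := exists_momentum_iterates a β (η₀ / n) (wt 0)
  have hcyc : IsCyclicMomentum n a (gradient F) β η₀ G L W M :=
    { one_le := hn
      beta_nonneg := hβ0
      beta_le_one := hβ1.le
      step_nonneg := hη₀pos.le
      lip_nonneg := hL.le
      periodic := fun s => by simp only [a, p, Nat.add_mod_right]
      average := fun x => (hgradF x).gradient
      bounded := fun s x => hbg _ x
      lipschitz := fun s x y => hsmooth _ x y
      momentum_zero := hM0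
      momentum_succ := hM1
      iterate_succ := hW1 }
  have hepoch : ∀ t, t < T → wt t = W (t * n) → mt t = M (t * n) →
      ∀ i, i ≤ n → w (t + 1) i = W (t * n + i) ∧ m (t + 1) i = M (t * n + i) := by
    intro t ht hwt' hmt' i
    induction i with
    | zero =>
      intro _
      rw [hw0 (t + 1) (by omega) ht, hm0 (t + 1) (by omega) ht]
      exact ⟨hwt', hmt'⟩
    | succ i ih =>
      intro hi
      obtain ⟨ihw, ihm⟩ := ih (by omega)
      have hgi : g (t + 1) i = a (t * n + i) (W (t * n + i)) := by
        rw [hg (t + 1) (by omega) ht i hi, ihw]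
        simp only [a, p, Nat.mul_add_mod_self_right, Nat.mod_eq_of_lt (Nat.lt_of_succ_le hi)]
      have hmi : m (t + 1) (i + 1) = M (t * n + (i + 1)) := by
        rw [hm1 (t + 1) (by omega) ht i hi, ihm, hgi, ← add_assoc, hM1]
      refine ⟨?_, hmi⟩
      rw [hw1 (t + 1) (by omega) ht i hi, hmi, ihw, hη', ← add_assoc, hW1]
  have hstart : ∀ t, t ≤ T → wt t = W (t * n) ∧ mt t = M (t * n) := by
    intro t
    induction t with
    | zero => simp [hW0, hM0, hmt0]
    | succ t ih =>
      intro ht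
      obtain ⟨ihw, ihm⟩ := ih (by omega)
      rw [hwt (t + 1) (by omega) ht, hmt (t + 1) (by omega) ht, Nat.succ_mul]
      exact hepoch t ht ihw ihm n le_rfl
  have hmain := hcyc.sum_sq_norm_gradient_le
    (fun x => (hgradF x).gradient.symm ▸ hgradF x) hL hη₀L (T - 1)
  rw [Nat.sub_add_cancel hT] at hmain
  have hsum : ∑ t ∈ Icc 1 T, η t * ‖gradient F (wt (t - 1))‖ ^ 2
      = η₀ * ∑ t ∈ range T, ‖gradient F (W (t * n))‖ ^ 2 := by
    rw [mul_sum, range_eq_Ico, ← Ico_add_one_right_eq_Icc, sum_Ico_eq_sum_range,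
      Nat.add_sub_cancel, ← range_eq_Ico]
    refine sum_congr rfl fun t ht => ?_
    rw [hη', Nat.add_sub_cancel_left, (hstart t (mem_range.1 ht).le).1]
  have hsumη : ∑ t ∈ Icc 1 T, η t = T * η₀ := by
    simp [hη']
  have hlow : ∀ x, Fstar ≤ F x := fun x => hFstar.1 ⟨x, rfl⟩
  have hTcast : ((T - 1 : ℕ) : ℝ) ≤ T := by exact_mod_cast Nat.sub_le T 1
  rw [hsum, hsumη, hc2, hc4, ← hW0, div_le_iff₀ (by positivity)]
  set P := ‖gradient F (W 0)‖ ^ 2 with hP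
  have hP0 : 0 ≤ P := sq_nonneg _
  have hΔ : 0 ≤ F (W 0) - Fstar := sub_nonneg.2 (hlow _)
  have hupper : η₀ * ∑ t ∈ range T, ‖gradient F (W (t * n))‖ ^ 2
      ≤ 2 * (F (W 0) - Fstar) + η₀ * P + 1 / L * P + 2 * L * η₀ ^ 2 * G ^ 2
        + T * (η₀ * (ν / c ^ 2 * (4 * G ^ 2) + (L * (η₀ * G)) ^ 2)) := by
    rw [hβn] at hmain
    have herr : 0 ≤ η₀ / 2 * (ν / c ^ 2 * (4 * G ^ 2) + (L * (η₀ * G)) ^ 2) := by positivity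
    have hhalf : 1 / L * P = 2 * (1 / (2 * L) * P) := by field_simp
    nlinarith [hlow (W (T * n)), mul_le_mul_of_nonneg_right hTcast herr]
  have hscale : ∀ x : ℝ, 0 ≤ x → x ≤ R * x := fun x hx => le_mul_of_one_le_left hx hR
  have hR₁ := hscale _ (mul_nonneg zero_le_two hΔ)
  have hR₂ := hscale (η₀ * P + 1 / L * P + 2 * L * η₀ ^ 2 * G ^ 2) (by positivity)
  have hR₃ := hscale (T * (η₀ * (ν / c ^ 2 * (4 * G ^ 2)))) (by positivity)
  refine (hupper.trans (c := R * (2 * (F (W 0) - Fstar))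
    + R * (η₀ * P + 1 / L * P + 2 * L * η₀ ^ 2 * G ^ 2)
    + R * (T * (η₀ * (ν / c ^ 2 * (4 * G ^ 2)))) + T * (η₀ * (L * (η₀ * G)) ^ 2))
    (by linarith)).trans_eq ?_
  rw [hc3, hη₀]
  field_simp
  ring
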